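/- Let r = s + v with s ∈ ℕ₀ and 0 < v ≤ 1, c₀ > 0, and let f be an (r, c₀)-smooth function on [0,1]^d. For N ∈ ℕ define f₁(x) = Σ_{j ∈ {0,1,…,N}^d} φ_{j,N}(x) p_{s, j/N, f}(x), where j/N = (j₁/N, …, j_d/N). Then there exists a constant c̃₂ depending only on r, c₀ and d (one may take c̃₂ = c̃₁ 2^d d^{r/2} with c̃₁ the Taylor remainder constant) such that |f(x) − f₁(x)| ≤ c̃₂ N^{−r} for all x ∈ [0,1]^d. -/

import Mathlib

open scoped Classical BigOperators

noncomputable section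

/-- The ReLU activation. -/
def relu (t : ℝ) : ℝ := max t 0

/-- The cube `[0,1]^d`. -/
def cube01 (d : ℕ) : Set (Fin d → ℝ) := {x | ∀ i, 0 ≤ x i ∧ x i ≤ 1}

/-- The Euclidean norm on `Fin d → ℝ`. -/
def enorm2 {d : ℕ} (x : Fin d → ℝ) : ℝ := Real.sqrt (∑ i, (x i) ^ 2)

/-- `ψ(t) = σ(t+2) − σ(t+1) − σ(t−1) + σ(t−2)`. -/
def psiFn (t : ℝ) : ℝ := relu (t + 2) - relu (t + 1) - relu (t - 1) + relu (t - 2)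

/-- `φ_{j,N}(x) = ∏_k ψ(3N(x^{(k)} − j_k/N))` for `j ∈ {0,…,N}^d`. -/
def phiFn (d N : ℕ) (j : Fin d → Fin (N + 1)) (x : Fin d → ℝ) : ℝ :=
  ∏ k, psiFn (3 * N * (x k - (j k : ℝ) / N))

/-- `f` is `(s+v, c₀)`-smooth on `[0,1]^d`. -/
def LipSmooth01 (d s : ℕ) (v c₀ : ℝ) (f : (Fin d → ℝ) → ℝ) : Prop :=
  ContDiffOn ℝ s f (cube01 d) ∧
    ∀ k : Fin s → Fin d, ∀ x ∈ cube01 d, ∀ x' ∈ cube01 d,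
      |iteratedFDerivWithin ℝ s f (cube01 d) x (fun j => Pi.single (k j) 1) -
          iteratedFDerivWithin ℝ s f (cube01 d) x' (fun j => Pi.single (k j) 1)| ≤
        c₀ * (enorm2 (x - x')) ^ v

/-- The Taylor polynomial of `f` of degree `s` at `x₀`, evaluated at `x`. -/
def taylorPoly01 (d s : ℕ) (f : (Fin d → ℝ) → ℝ) (x₀ x : Fin d → ℝ) : ℝ :=
  ∑ m ∈ Finset.range (s + 1),
    (1 / (Nat.factorial m : ℝ)) *
      iteratedFDerivWithin ℝ m f (cube01 d) x₀ (fun _ => x - x₀)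

/-- The partition-of-unity Taylor approximant
`f₁(x) = Σ_{j ∈ {0,…,N}^d} φ_{j,N}(x) p_{s,j/N,f}(x)`. -/
def f1Approx (d s N : ℕ) (f : (Fin d → ℝ) → ℝ) (x : Fin d → ℝ) : ℝ :=
  ∑ j : Fin d → Fin (N + 1),
    phiFn d N j x * taylorPoly01 d s f (fun k => (j k : ℝ) / N) x

/-- Taylor's estimate for a chain of derivatives on `[0,1]`: if the last one deviates from its
initial value by at most `C`, so does the first from its Taylor polynomial. -/
theorem abs_sub_taylor_sum_le (s : ℕ) {C : ℝ} (hC : 0 ≤ C) (G : ℕ → ℝ → ℝ)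
    (hG : ∀ m < s, ∀ t ∈ Set.Icc (0 : ℝ) 1,
      HasDerivWithinAt (G m) (G (m + 1) t) (Set.Icc 0 1) t)
    (hs : ∀ t ∈ Set.Icc (0 : ℝ) 1, |G s t - G s 0| ≤ C) :
    ∀ t ∈ Set.Icc (0 : ℝ) 1,
      |G 0 t - ∑ m ∈ Finset.range (s + 1), G m 0 * t ^ m / (m.factorial : ℝ)| ≤ C := by
  induction s generalizing G with
  | zero => simpa using hs
  | succ s ih =>
    intro t ht
    have ih' := ih (fun m => G (m + 1)) (fun m hm => hG (m + 1) (by omega)) hs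
    have hder : ∀ u ∈ Set.Icc (0 : ℝ) 1, HasDerivWithinAt
        (fun u => G 0 u - ∑ m ∈ Finset.range (s + 1 + 1), G m 0 * u ^ m / (m.factorial : ℝ))
        (G 1 u - ∑ m ∈ Finset.range (s + 1), G (m + 1) 0 * u ^ m / (m.factorial : ℝ))
        (Set.Icc 0 1) u := by
      intro u hu
      refine (hG 0 (by omega) u hu).sub ?_
      have hsum : HasDerivWithinAt
          (fun u => ∑ m ∈ Finset.range (s + 1 + 1), G m 0 * u ^ m / (m.factorial : ℝ))
          (∑ m ∈ Finset.range (s + 1 + 1),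
            G m 0 * ((m : ℝ) * u ^ (m - 1)) / (m.factorial : ℝ)) (Set.Icc 0 1) u :=
        HasDerivWithinAt.fun_sum fun m _ =>
          (((hasDerivAt_pow m u).hasDerivWithinAt).const_mul (G m 0)).div_const _
      rw [Finset.sum_range_succ'] at hsum
      refine hsum.congr_deriv ?_
      simp only [Nat.cast_zero, zero_mul, mul_zero, zero_div, add_zero, Nat.add_sub_cancel]
      refine Finset.sum_congr rfl fun m _ => ?_
      rw [Nat.factorial_succ]
      push_cast
      field_simp
    have hmv := (convex_Icc (0 : ℝ) 1).norm_image_sub_le_of_norm_hasDerivWithin_le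
      hder (fun u hu => ih' u hu) (Set.left_mem_Icc.2 zero_le_one) ht
    have h0 : ∑ m ∈ Finset.range (s + 1 + 1), G m 0 * (0 : ℝ) ^ m / (m.factorial : ℝ) = G 0 0 := by
      rw [Finset.sum_range_succ']
      simp
    simp only [h0, sub_self, sub_zero, Real.norm_eq_abs, abs_of_nonneg ht.1] at hmv
    exact hmv.trans (mul_le_of_le_one_right hC ht.2)

theorem cube01_eq_Icc (d : ℕ) : cube01 d = Set.Icc 0 1 := by
  ext x
  simp only [cube01, Set.mem_ofPred_eq, Set.mem_Icc, Pi.le_def, Pi.zero_apply, Pi.one_apply,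
    forall_and]

theorem convex_cube01 (d : ℕ) : Convex ℝ (cube01 d) := by
  rw [cube01_eq_Icc]
  exact convex_Icc 0 1

theorem uniqueDiffOn_cube01 (d : ℕ) : UniqueDiffOn ℝ (cube01 d) := by
  have h : cube01 d = Set.univ.pi fun _ => Set.Icc (0 : ℝ) 1 := by
    ext x
    simp only [cube01, Set.mem_ofPred_eq, Set.mem_univ_pi, Set.mem_Icc]
  rw [h]
  exact UniqueDiffOn.univ_pi fun _ => uniqueDiffOn_Icc zero_lt_one

theorem hasDerivWithinAt_iteratedFDerivWithin_line {d s m : ℕ} (hm : m < s)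
    {f : (Fin d → ℝ) → ℝ} (hf : ContDiffOn ℝ s f (cube01 d)) {x₀ x : Fin d → ℝ}
    (hx₀ : x₀ ∈ cube01 d) (hx : x ∈ cube01 d) {t : ℝ} (ht : t ∈ Set.Icc (0 : ℝ) 1) :
    HasDerivWithinAt
      (fun u : ℝ => iteratedFDerivWithin ℝ m f (cube01 d) (x₀ + u • (x - x₀)) fun _ => x - x₀)
      (iteratedFDerivWithin ℝ (m + 1) f (cube01 d) (x₀ + t • (x - x₀)) fun _ => x - x₀)
      (Set.Icc 0 1) t := by
  have hmaps : Set.MapsTo (fun u : ℝ => x₀ + u • (x - x₀)) (Set.Icc 0 1) (cube01 d) :=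
    fun u hu => (convex_cube01 d).add_smul_sub_mem hx₀ hx hu
  have hF := (hf.differentiableOn_iteratedFDerivWithin (by exact_mod_cast hm)
    (uniqueDiffOn_cube01 d) _ (hmaps ht)).hasFDerivWithinAt
  have hline : HasDerivWithinAt (fun u : ℝ => x₀ + u • (x - x₀)) (x - x₀) (Set.Icc 0 1) t := by
    simpa using (((hasDerivAt_id t).smul_const (x - x₀)).const_add x₀).hasDerivWithinAt
  have hcomp := hF.comp_hasDerivWithinAt t hline hmaps
  have happ := (ContinuousMultilinearMap.apply ℝ (fun _ : Fin m => Fin d → ℝ) ℝ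
    (fun _ => x - x₀)).hasFDerivAt.comp_hasDerivWithinAt t hcomp
  rw [iteratedFDerivWithin_succ_apply_left]
  exact happ

theorem enorm2_le {d : ℕ} {x : Fin d → ℝ} {H : ℝ} (hH : 0 ≤ H) (hx : ∀ i, |x i| ≤ H) :
    enorm2 x ≤ √d * H := by
  refine Real.sqrt_le_iff.2 ⟨by positivity, ?_⟩
  rw [mul_pow, Real.sq_sqrt (Nat.cast_nonneg d)]
  calc ∑ i, x i ^ 2 ≤ ∑ _i : Fin d, H ^ 2 :=
        Finset.sum_le_sum fun i _ => sq_le_sq' (abs_le.1 (hx i)).1 (abs_le.1 (hx i)).2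
    _ = d * H ^ 2 := by simp

/-- A multilinear form bounded on the standard basis vectors is bounded on small vectors. -/
theorem abs_multilinear_le {d s : ℕ} (M : ContinuousMultilinearMap ℝ (fun _ : Fin s => Fin d → ℝ) ℝ)
    {B H : ℝ} (hM : ∀ k : Fin s → Fin d, |M fun j => Pi.single (k j) 1| ≤ B)
    {h : Fin d → ℝ} (hh : ∀ i, |h i| ≤ H) :
    |M fun _ => h| ≤ d ^ s * (H ^ s * B) := by
  have hexp : (M fun _ => h) =
      ∑ k : Fin s → Fin d, (∏ j, h (k j)) * M fun j => Pi.single (k j) 1 := by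
    have hsum : h = ∑ i, h i • (Pi.single i 1 : Fin d → ℝ) := by
      ext i
      simp [Finset.sum_apply, Pi.single_apply]
    conv_lhs => rw [hsum]
    rw [M.map_sum (fun _ i => h i • (Pi.single i 1 : Fin d → ℝ))]
    refine Finset.sum_congr rfl fun k _ => ?_
    rw [M.map_smul_univ (fun j => h (k j)) fun j => Pi.single (k j) 1, smul_eq_mul]
  rw [hexp]
  calc |∑ k : Fin s → Fin d, (∏ j, h (k j)) * M fun j => Pi.single (k j) 1|
      ≤ ∑ k : Fin s → Fin d, |(∏ j, h (k j)) * M fun j => Pi.single (k j) 1| :=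
        Finset.abs_sum_le_sum_abs _ _
    _ ≤ ∑ _k : Fin s → Fin d, H ^ s * B := by
        refine Finset.sum_le_sum fun k _ => ?_
        rw [abs_mul, Finset.abs_prod]
        have hprod : ∏ j, |h (k j)| ≤ H ^ s := by
          simpa using Finset.prod_le_prod (s := Finset.univ)
            (fun j _ => abs_nonneg (h (k j))) (fun j _ => hh (k j))
        exact mul_le_mul hprod (hM k) (abs_nonneg _)
          ((Finset.prod_nonneg fun j _ => abs_nonneg _).trans hprod)
    _ = d ^ s * (H ^ s * B) := by simp

theorem abs_sub_taylorPoly01_le {d s : ℕ} {v c₀ : ℝ} (hv : 0 < v) (hc₀ : 0 < c₀)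
    {f : (Fin d → ℝ) → ℝ} (hf : LipSmooth01 d s v c₀ f) {x₀ x : Fin d → ℝ}
    (hx₀ : x₀ ∈ cube01 d) (hx : x ∈ cube01 d) {H : ℝ} (hH : 0 ≤ H)
    (hxH : ∀ i, |x i - x₀ i| ≤ H) :
    |f x - taylorPoly01 d s f x₀ x| ≤ d ^ s * (H ^ s * (c₀ * (√d * H) ^ v)) := by
  have key := abs_sub_taylor_sum_le s
    (C := d ^ s * (H ^ s * (c₀ * (√d * H) ^ v))) (by positivity)
    (fun m u => iteratedFDerivWithin ℝ m f (cube01 d) (x₀ + u • (x - x₀)) fun _ => x - x₀)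
    (fun m hm t ht => hasDerivWithinAt_iteratedFDerivWithin_line hm hf.1 hx₀ hx ht)
    (fun t ht => by
      have hmem := (convex_cube01 d).add_smul_sub_mem hx₀ hx ht
      simp only [zero_smul, add_zero]
      rw [← sub_apply]
      refine abs_multilinear_le _ (fun k => ?_) hxH
      rw [sub_apply]
      refine (hf.2 k _ hmem _ hx₀).trans ?_
      have hnorm : enorm2 (x₀ + t • (x - x₀) - x₀) ≤ √d * H := by
        refine enorm2_le hH fun i => ?_
        rw [add_sub_cancel_left, Pi.smul_apply, Pi.sub_apply, smul_eq_mul, abs_mul,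
          abs_of_nonneg ht.1]
        exact (mul_le_of_le_one_left (abs_nonneg _) ht.2).trans (hxH i)
      exact mul_le_mul_of_nonneg_left
        (Real.rpow_le_rpow (Real.sqrt_nonneg _) hnorm hv.le) hc₀.le)
    1 (Set.right_mem_Icc.2 zero_le_one)
  simpa [taylorPoly01, div_eq_inv_mul] using key

theorem psiFn_nonneg (t : ℝ) : 0 ≤ psiFn t := by
  unfold psiFn relu
  grind

theorem psiFn_eq_zero {t : ℝ} (ht : 2 ≤ |t|) : psiFn t = 0 := by
  unfold psiFn relu
  grind

theorem sum_psiFn {N : ℕ} (hN : 0 < N) {x : ℝ} (hx : 0 ≤ x ∧ x ≤ 1) :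
    ∑ j : Fin (N + 1), psiFn (3 * N * (x - (j : ℝ) / N)) = 1 := by
  have hN' : (0 : ℝ) < N := Nat.cast_pos.2 hN
  have hstep : ∀ j : ℕ, psiFn (3 * N * (x - (j : ℝ) / N)) =
      (relu (3 * N * x - 3 * (j : ℝ) + 2) - relu (3 * N * x - 3 * (j : ℝ) + 1)) -
      (relu (3 * N * x - 3 * ((j + 1 : ℕ) : ℝ) + 2) -
        relu (3 * N * x - 3 * ((j + 1 : ℕ) : ℝ) + 1)) := by
    intro j
    have h : 3 * N * (x - (j : ℝ) / N) = 3 * N * x - 3 * (j : ℝ) := by field_simp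
    rw [h, psiFn]
    push_cast
    ring_nf
  rw [Fin.sum_univ_eq_sum_range (fun j : ℕ => psiFn (3 * N * (x - (j : ℝ) / N)))]
  simp only [hstep]
  rw [Finset.sum_range_sub'
    (fun j : ℕ => relu (3 * N * x - 3 * (j : ℝ) + 2) - relu (3 * N * x - 3 * (j : ℝ) + 1))]
  have h1 : 0 ≤ 3 * N * x := by have := hx.1; positivity
  have h2 : 3 * N * x ≤ 3 * N := mul_le_of_le_one_right (by positivity) hx.2
  push_cast
  unfold relu
  grind

theorem phiFn_nonneg (d N : ℕ) (j : Fin d → Fin (N + 1)) (x : Fin d → ℝ) : 0 ≤ phiFn d N j x :=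
  Finset.prod_nonneg fun _ _ => psiFn_nonneg _

theorem sum_phiFn {d N : ℕ} (hN : 0 < N) {x : Fin d → ℝ} (hx : x ∈ cube01 d) :
    ∑ j : Fin d → Fin (N + 1), phiFn d N j x = 1 := by
  have h := Finset.prod_univ_sum (fun _ : Fin d => (Finset.univ : Finset (Fin (N + 1))))
    (fun k j => psiFn (3 * N * (x k - (j : ℝ) / N)))
  rw [Fintype.piFinset_univ] at h
  exact h.symm.trans (Finset.prod_eq_one fun k _ => sum_psiFn hN (hx k))

theorem abs_sub_le_of_phiFn_ne_zero {d N : ℕ} (hN : 0 < N) {j : Fin d → Fin (N + 1)}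
    {x : Fin d → ℝ} (h : phiFn d N j x ≠ 0) (k : Fin d) :
    |x k - (j k : ℝ) / N| ≤ (N : ℝ)⁻¹ := by
  have hN' : (0 : ℝ) < N := Nat.cast_pos.2 hN
  by_contra! hk
  refine h (Finset.prod_eq_zero (Finset.mem_univ k) (psiFn_eq_zero ?_))
  rw [abs_mul, abs_of_pos (by positivity : (0 : ℝ) < 3 * N)]
  have := mul_lt_mul_of_pos_left hk (by positivity : (0 : ℝ) < 3 * N)
  rw [mul_assoc 3 (N : ℝ) (N : ℝ)⁻¹, mul_inv_cancel₀ hN'.ne'] at this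
  linarith

/-- Lemma 8 of the paper: approximation by localized Taylor
polynomials.  Let `r = s + v`, `0 < v ≤ 1`, `c₀ > 0` and let `f` be `(r,c₀)`-smooth
on `[0,1]^d`.  Then there is `c̃₂ > 0` depending only on `r, c₀, d` such that
`|f(x) − f₁(x)| ≤ c̃₂ N^{-r}` for all `x ∈ [0,1]^d` and all `N ∈ ℕ`, `N ≥ 1`. -/
theorem localized_taylor_approx (d s : ℕ) (hd : 0 < d) (v c₀ : ℝ) (hv : 0 < v)
    (hv1 : v ≤ 1) (hc₀ : 0 < c₀) :
    ∃ c2 : ℝ, 0 < c2 ∧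
      ∀ f : (Fin d → ℝ) → ℝ, LipSmooth01 d s v c₀ f →
        ∀ N : ℕ, 0 < N → ∀ x ∈ cube01 d,
          |f x - f1Approx d s N f x| ≤ c2 * (N : ℝ) ^ (-((s : ℝ) + v)) := by
  refine ⟨d ^ s * c₀ * √d ^ v, by positivity, fun f hf N hN x hx => ?_⟩
  have hN' : (0 : ℝ) < N := Nat.cast_pos.2 hN
  have hconst : (d : ℝ) ^ s * ((N : ℝ)⁻¹ ^ s * (c₀ * (√d * (N : ℝ)⁻¹) ^ v)) =
      d ^ s * c₀ * √d ^ v * (N : ℝ) ^ (-((s : ℝ) + v)) := by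
    rw [Real.mul_rpow (Real.sqrt_nonneg _) (by positivity), Real.rpow_neg hN'.le,
      Real.rpow_add hN', Real.rpow_natCast, Real.inv_rpow hN'.le, inv_pow, mul_inv]
    ring
  have hdiff : f x - f1Approx d s N f x = ∑ j : Fin d → Fin (N + 1),
      phiFn d N j x * (f x - taylorPoly01 d s f (fun k => (j k : ℝ) / N) x) := by
    simp only [f1Approx, mul_sub, Finset.sum_sub_distrib, ← Finset.sum_mul, sum_phiFn hN hx,
      one_mul]
  rw [hdiff, ← hconst, ← one_mul ((d : ℝ) ^ s * _), ← sum_phiFn hN hx, Finset.sum_mul]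
  refine (Finset.abs_sum_le_sum_abs _ _).trans (Finset.sum_le_sum fun j _ => ?_)
  rw [abs_mul, abs_of_nonneg (phiFn_nonneg d N j x)]
  by_cases hj : phiFn d N j x = 0
  · simp [hj]
  · have hnode : (fun k => (j k : ℝ) / N) ∈ cube01 d := fun k =>
      ⟨by positivity, div_le_one_of_le₀
        (by exact_mod_cast Nat.lt_succ_iff.1 (j k).isLt) hN'.le⟩
    exact mul_le_mul_of_nonneg_left
      (abs_sub_taylorPoly01_le hv hc₀ hf hnode hx (by positivity)
        (abs_sub_le_of_phiFn_ne_zero hN hj)) (phiFn_nonneg d N j x)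

end
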